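/- In the general hierarchical Poisson model, fix D_0 ∈ {1,…,D}. For 0 ≤ D' ≤ D_0 define a^{(D_0)}(D') ∈ (0,∞)^{1+D} by a^{(D_0)}(D')_d = (1/2)·Π_{d'=d+1}^D n_{d'}^{ε(d')} for 0 ≤ d ≤ D_0−1, where ε(d') = 1 if d' ≤ D' or d' ≥ D_0+1 and ε(d') = 0 otherwise, and a^{(D_0)}(D')_d = (1/2)·Π_{d'=d+1}^D n_{d'} for D_0 ≤ d ≤ D. Let a* = (1/2)·Π_{d'=D_0+1}^D n_{d'}. Suppose n_{D'} ≥ 2 for all D' = 1,…,D_0, a* ≥ 2, and ((2+D−D_0)/(D_0−1))·((a*−1)/a*) ≥ n_{D'}·(n_{D'−1}·a*)/(n_{D'−1}·a* − 2) for all D' = 2,…,D_0. Then for every D' ∈ {1,…,D_0} and every parameter λ (all entries positive), R̃(λ̂^{(a^{(D_0)}(D'−1))}(X(0)), λ) < R̃(λ̂^{(a^{(D_0)}(D'))}(X(0)), λ); in particular, using all the data, the Bayes estimator under the Jeffreys prior (exponents a^{(D_0)}(D_0)) is strictly dominated by the Bayes estimator under the prior with exponents a^{(D_0)}(0). -/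

import Mathlib

open scoped BigOperators ENNReal

/-- The Poisson(μ) probability of the value `k`. -/
noncomputable def poissonPmf (mu : ℝ) (k : ℕ) : ℝ :=
  mu ^ k * Real.exp (-mu) / (Nat.factorial k)

/-- The index set I_d = Π_{d'=1}^d {1,…,n_{d'}} of level d of the hierarchy. -/
abbrev Idx (n : ℕ → ℕ) (d : ℕ) := (k : Fin d) → Fin (n (k.val + 1))

/-- Restriction of a level-e index to its first d coordinates. -/
def resIdx (n : ℕ → ℕ) {d e : ℕ} (h : d ≤ e) (j : Idx n e) : Idx n d :=
  fun k => j (Fin.castLE h k)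

/-- Marginal sum v_{(i_1,…,i_d)} = Σ over extensions j ∈ I_D of i of v_j. -/
noncomputable def marg (n : ℕ → ℕ) (D : ℕ) (v : Idx n D → ℝ) {d : ℕ} (h : d ≤ D)
    (i : Idx n d) : ℝ :=
  ∑ j : Idx n D, if resIdx n h j = i then v j else 0

/-- The sample space: one observation X_{(i_1,…,i_d)} ∈ ℕ for each level d = 0,…,D
and each index in I_d. -/
abbrev Obs (n : ℕ → ℕ) (D : ℕ) := (d : Fin (D + 1)) → Idx n d.val → ℕ

/-- Joint pmf of the hierarchical observations: all X_{(i_1,…,i_d)} independent,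
X_{(i_1,…,i_d)} ~ Po(λ_{(i_1,…,i_d)}). -/
noncomputable def hierPmf (n : ℕ → ℕ) (D : ℕ) (lam : Idx n D → ℝ) (X : Obs n D) : ℝ :=
  ∏ d : Fin (D + 1), ∏ i : Idx n d.val,
    poissonPmf (marg n D lam (Nat.lt_succ_iff.mp d.isLt) i) (X d i)

/-- X̃_{(i_1,…,i_d,+)}(D') = Σ_{d'=d}^D Σ_{extensions j ∈ I_{d'} of i} X̃_{(j)}(D'),
where X̃_{(j)}(D') = X_{(j)} if the level of j is ≥ D' and 0 otherwise. -/
def plusSum (n : ℕ → ℕ) (D : ℕ) (X : Obs n D) (D' : ℕ) {d : ℕ} (hd : d ≤ D)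
    (i : Idx n d) : ℕ :=
  ∑ d' : Fin (D + 1), if h : d ≤ d'.val then
    ∑ j : Idx n d'.val, if resIdx n h j = i ∧ D' ≤ d'.val then X d' j else 0
  else 0

/-- The generalized Bayes estimator λ̂^{(a)}(X(D')) under the prior with exponents a,
based on the data at levels D', D'+1, …, D. Its (i_1,…,i_D)-component is
((X̃_{(+)}(D') + a_0)/(1+D−D'))·Π_{d=1}^D (X̃_{(i_1,…,i_d,+)}(D') + a_d) /
(Σ_{i_d'} X̃_{(i_1,…,i_{d−1},i_d',+)}(D') + n_d a_d). -/
noncomputable def hierBayes (n : ℕ → ℕ) (D : ℕ) (a : ℕ → ℝ) (D' : ℕ) (X : Obs n D)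
    (j : Idx n D) : ℝ :=
  (((plusSum n D X D' (Nat.zero_le D) (fun k => k.elim0) : ℕ) : ℝ) + a 0) /
      (1 + (D : ℝ) - (D' : ℝ)) *
    ∏ d : Fin D,
      (((plusSum n D X D' d.isLt (resIdx n d.isLt j) : ℕ) : ℝ) + a (d.val + 1)) /
        ((∑ i2 : Idx n (d.val + 1),
            if resIdx n (Nat.le_succ d.val) i2 = resIdx n (le_of_lt d.isLt) j
            then ((plusSum n D X D' d.isLt i2 : ℕ) : ℝ) else 0) +
          (n (d.val + 1) : ℝ) * a (d.val + 1))

/-- Entropy loss L̃^KL(δ, λ) = Σ_{d=0}^D Σ_{i ∈ I_d}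
λ_{(i)}·(δ_{(i)}/λ_{(i)} − 1 − log(δ_{(i)}/λ_{(i)})). -/
noncomputable def hierLoss (n : ℕ → ℕ) (D : ℕ) (δ : Idx n D → ℝ) (lam : Idx n D → ℝ) : ℝ :=
  ∑ d : Fin (D + 1), ∑ i : Idx n d.val,
    marg n D lam (Nat.lt_succ_iff.mp d.isLt) i *
      (marg n D δ (Nat.lt_succ_iff.mp d.isLt) i / marg n D lam (Nat.lt_succ_iff.mp d.isLt) i
        - 1 -
        Real.log (marg n D δ (Nat.lt_succ_iff.mp d.isLt) i /
          marg n D lam (Nat.lt_succ_iff.mp d.isLt) i))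

/-- Entropy risk R̃(δ, λ) of an estimator δ of λ based on X, valued in [0,∞]. -/
noncomputable def hierRisk (n : ℕ → ℕ) (D : ℕ) (δ : Obs n D → Idx n D → ℝ)
    (lam : Idx n D → ℝ) : ℝ≥0∞ :=
  ∑' X : Obs n D, ENNReal.ofReal (hierLoss n D (δ X) lam * hierPmf n D lam X)

/-- The exponent vectors a^{(D_0)}(D'): for d < D_0,
a^{(D_0)}(D')_d = (1/2)·Π_{d'=d+1}^D n_{d'}^{ε(d')} with ε(d') = 1 iff d' ≤ D' or
d' ≥ D_0+1; for d ≥ D_0, a^{(D_0)}(D')_d = (1/2)·Π_{d'=d+1}^D n_{d'}. -/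
noncomputable def aD0 (n : ℕ → ℕ) (D D0 D' : ℕ) (d : ℕ) : ℝ :=
  if d < D0 then
    (∏ d' ∈ Finset.Icc (d + 1) D, if d' ≤ D' ∨ D0 + 1 ≤ d' then (n d' : ℝ) else 1) / 2
  else (∏ d' ∈ Finset.Icc (d + 1) D, (n d' : ℝ)) / 2

section Shift

variable {ι : Type*} [DecidableEq ι]

/-- Adding one to the coordinate `s`. -/
def shiftAt (s : ι) (X : ι → ℕ) : ι → ℕ := Function.update X s (X s + 1)

lemma shiftAt_injective (s : ι) : Function.Injective (shiftAt s) := by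
  intro X Y h
  funext t
  have := congrFun h t
  by_cases ht : t = s
  · subst ht; simpa [shiftAt] using this
  · simpa [shiftAt, ht] using this

/-- The total of the coordinates in `A`. -/
def total (A : Finset ι) (X : ι → ℕ) : ℕ := ∑ s ∈ A, X s

lemma total_shiftAt_of_mem {A : Finset ι} {s : ι} (hs : s ∈ A) (X : ι → ℕ) :
    total A (shiftAt s X) = total A X + 1 := by
  unfold total shiftAt
  rw [Finset.sum_update_of_mem hs, Finset.sdiff_singleton_eq_erase,
    ← Finset.add_sum_erase _ _ hs]
  ring

lemma total_shiftAt_of_notMem {A : Finset ι} {s : ι} (hs : s ∉ A) (X : ι → ℕ) :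
    total A (shiftAt s X) = total A X := by
  unfold total shiftAt
  rw [Finset.sum_update_of_notMem hs]

end Shift

section ProductPoisson

open MeasureTheory ProbabilityTheory

variable {ι : Type*} [Fintype ι]

/-- The law of independent Poisson variables with means `m s`. -/
noncomputable def prodPoisson (m : ι → ℝ) : Measure (ι → ℕ) :=
  Measure.pi fun s => poissonMeasure (m s).toNNReal

instance (m : ι → ℝ) : IsProbabilityMeasure (prodPoisson m) := by
  unfold prodPoisson; infer_instance

lemma prodPoisson_singleton {m : ι → ℝ} (hm : ∀ s, 0 < m s) (X : ι → ℕ) :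
    prodPoisson m {X} = ENNReal.ofReal (∏ s, poissonPmf (m s) (X s)) := by
  rw [prodPoisson, Measure.pi_singleton, ENNReal.ofReal_prod_of_nonneg]
  · refine Finset.prod_congr rfl fun s _ => ?_
    rw [poissonMeasure_singleton, Real.coe_toNNReal _ (hm s).le, poissonPmf, mul_comm]
  · intro s _
    have := hm s
    unfold poissonPmf
    positivity

lemma poissonPmf_succ (mu : ℝ) (k : ℕ) :
    ((k + 1 : ℕ) : ℝ) * poissonPmf mu (k + 1) = mu * poissonPmf mu k := by
  unfold poissonPmf
  rw [Nat.factorial_succ]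
  have : ((k + 1 : ℕ) : ℝ) ≠ 0 := by positivity
  have h2 : (k.factorial : ℝ) ≠ 0 := by positivity
  push_cast at *
  field_simp
  ring

lemma integrable_of_bounded {m : ι → ℝ} {f : (ι → ℕ) → ℝ} (C : ℝ) (hC : ∀ X, |f X| ≤ C) :
    Integrable f (prodPoisson m) :=
  Integrable.of_bound Measurable.of_discrete.aestronglyMeasurable C
    (Filter.Eventually.of_forall hC)

variable [DecidableEq ι]

lemma prodPoisson_withDensity {m : ι → ℝ} (hm : ∀ s, 0 < m s) (s : ι) :
    (prodPoisson m).withDensity (fun X => (X s : ℝ≥0∞)) =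
      ENNReal.ofReal (m s) • (prodPoisson m).map (shiftAt s) := by
  refine Measure.ext_of_singleton fun X => ?_
  rw [withDensity_apply _ (measurableSet_singleton X), Measure.restrict_singleton,
    lintegral_smul_measure, lintegral_dirac, Measure.smul_apply,
    Measure.map_apply .of_discrete (measurableSet_singleton X)]
  simp only [smul_eq_mul]
  by_cases hX : X s = 0
  · have : shiftAt s ⁻¹' {X} = ∅ := by
      ext Y
      simp only [Set.mem_preimage, Set.mem_singleton_iff, Set.mem_empty_iff_false, iff_false]
      rintro rfl
      simp [shiftAt] at hX
    simp [this, hX]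
  · obtain ⟨Y, rfl⟩ : ∃ Y, shiftAt s Y = X :=
      ⟨Function.update X s (X s - 1), by
        simp only [shiftAt, Function.update_self, Function.update_idem]
        rw [Nat.sub_add_cancel (Nat.pos_of_ne_zero hX), Function.update_eq_self]⟩
    have : shiftAt s ⁻¹' {shiftAt s Y} = {Y} := by
      rw [← Set.image_singleton, Set.preimage_image_eq _ (shiftAt_injective s)]
    rw [this, prodPoisson_singleton hm, prodPoisson_singleton hm,
      ← ENNReal.ofReal_natCast, ← ENNReal.ofReal_mul' (by positivity),
      ← ENNReal.ofReal_mul (hm s).le]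
    congr 1
    rw [← Finset.mul_prod_erase _ _ (Finset.mem_univ s),
      ← Finset.mul_prod_erase _ (fun t => poissonPmf (m t) (Y t)) (Finset.mem_univ s)]
    have h1 : ∏ t ∈ Finset.univ.erase s, poissonPmf (m t) (shiftAt s Y t) =
        ∏ t ∈ Finset.univ.erase s, poissonPmf (m t) (Y t) := by
      refine Finset.prod_congr rfl fun t ht => ?_
      rw [shiftAt, Function.update_of_ne (Finset.ne_of_mem_erase ht)]
    have h2 := poissonPmf_succ (m s) (Y s)
    have h3 : shiftAt s Y s = Y s + 1 := by simp [shiftAt]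
    rw [h1, h3, mul_comm, ← mul_assoc, h2, mul_assoc]

/-- The Poisson (Stein–Chen) identity in one coordinate. -/
lemma integral_coord_mul {m : ι → ℝ} (hm : ∀ s, 0 < m s) (s : ι) (f : (ι → ℕ) → ℝ) :
    ∫ X, (X s : ℝ) * f X ∂prodPoisson m = m s * ∫ X, f (shiftAt s X) ∂prodPoisson m := by
  have h := integral_withDensity_eq_integral_toReal_smul (μ := prodPoisson m)
    (f := fun X : ι → ℕ => (X s : ℝ≥0∞)) .of_discrete (by simp) f
  rw [prodPoisson_withDensity hm, integral_smul_measure,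
    integral_map Measurable.of_discrete.aemeasurable
      (Measurable.of_discrete.aestronglyMeasurable),
    ENNReal.toReal_ofReal (hm s).le] at h
  simpa using h.symm

lemma integrable_coord_mul {m : ι → ℝ} (hm : ∀ s, 0 < m s) (s : ι) {f : (ι → ℕ) → ℝ}
    (hf : Integrable (fun X => f (shiftAt s X)) (prodPoisson m)) :
    Integrable (fun X => (X s : ℝ) * f X) (prodPoisson m) := by
  have h := integrable_withDensity_iff_integrable_smul' (μ := prodPoisson m)
    (f := fun X : ι → ℕ => (X s : ℝ≥0∞)) .of_discrete (by simp) (g := f)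
  rw [prodPoisson_withDensity hm] at h
  have h2 : Integrable f (ENNReal.ofReal (m s) • (prodPoisson m).map (shiftAt s)) := by
    refine Integrable.smul_measure ?_ (by simp)
    exact (integrable_map_measure Measurable.of_discrete.aestronglyMeasurable
      Measurable.of_discrete.aemeasurable).2 hf
  simpa using h.1 h2

lemma integrable_coord {m : ι → ℝ} (hm : ∀ s, 0 < m s) (s : ι) :
    Integrable (fun X => (X s : ℝ)) (prodPoisson m) := by
  simpa using integrable_coord_mul hm s (f := fun _ => 1) (integrable_const _)

lemma integrable_total {m : ι → ℝ} (hm : ∀ s, 0 < m s) (A : Finset ι) :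
    Integrable (fun X => (total A X : ℝ)) (prodPoisson m) := by
  simp only [total, Nat.cast_sum]
  exact integrable_finsetSum _ fun s _ => integrable_coord hm s

lemma integrable_of_linear_bound {m : ι → ℝ} (hm : ∀ s, 0 < m s) (A : Finset ι)
    {f : (ι → ℕ) → ℝ} (C : ℝ) (hC : ∀ X, |f X| ≤ total A X + C) :
    Integrable f (prodPoisson m) :=
  ((integrable_total hm A).add (integrable_const C)).mono'
    Measurable.of_discrete.aestronglyMeasurable (Filter.Eventually.of_forall hC)

/-- The Poisson identity for a total, which is Poisson with mean `∑ s ∈ A, m s`. -/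
lemma integral_total_mul {m : ι → ℝ} (hm : ∀ s, 0 < m s) (A : Finset ι) {f : ℕ → ℝ}
    (hf : Integrable (fun X => f (total A X + 1)) (prodPoisson m)) :
    ∫ X, (total A X : ℝ) * f (total A X) ∂prodPoisson m =
      (∑ s ∈ A, m s) * ∫ X, f (total A X + 1) ∂prodPoisson m := by
  have h1 : ∀ X : ι → ℕ, (total A X : ℝ) * f (total A X) =
      ∑ s ∈ A, (X s : ℝ) * f (total A X) := by
    intro X; rw [← Finset.sum_mul]; simp [total]
  simp_rw [h1]
  rw [integral_finsetSum, Finset.sum_mul]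
  · refine Finset.sum_congr rfl fun s hs => ?_
    rw [integral_coord_mul hm s fun X => f (total A X)]
    simp_rw [total_shiftAt_of_mem hs]
  · intro s hs
    refine integrable_coord_mul hm s (f := fun X => f (total A X)) ?_
    simpa only [total_shiftAt_of_mem hs] using hf

lemma integrable_total_mul {m : ι → ℝ} (hm : ∀ s, 0 < m s) (A : Finset ι) {f : ℕ → ℝ}
    (hf : Integrable (fun X => f (total A X + 1)) (prodPoisson m)) :
    Integrable (fun X => (total A X : ℝ) * f (total A X)) (prodPoisson m) := by
  have h1 : ∀ X : ι → ℕ, (total A X : ℝ) * f (total A X) =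
      ∑ s ∈ A, (X s : ℝ) * f (total A X) := by
    intro X; rw [← Finset.sum_mul]; simp [total]
  simp_rw [h1]
  refine integrable_finsetSum _ fun s hs => ?_
  refine integrable_coord_mul hm s (f := fun X => f (total A X)) ?_
  simpa only [total_shiftAt_of_mem hs] using hf

end ProductPoisson

section PoissonBounds

open MeasureTheory

lemma log_div_nonneg {x α β : ℝ} (hβ : 0 < x + β) (h : β ≤ α) :
    0 ≤ Real.log ((x + α) / (x + β)) :=
  Real.log_nonneg ((one_le_div hβ).2 (by linarith))

lemma log_div_le {x α β : ℝ} (hβ : 0 < x + β) (h : β ≤ α) :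
    Real.log ((x + α) / (x + β)) ≤ (α - β) / (x + β) := by
  have h1 : 0 < (x + α) / (x + β) := div_pos (by linarith) hβ
  refine (Real.log_le_sub_one_of_pos h1).trans (le_of_eq ?_)
  field_simp
  ring

lemma succ_mul_log_sub_le {x α β : ℝ} (hx : 0 ≤ x) (hβ : 1 < β) (h : β ≤ α) :
    (x + 1) * Real.log ((x + α) / (x + β)) - x * Real.log ((x - 1 + α) / (x - 1 + β)) ≤
      (α - β) * α / ((x + α) * (x + β)) := by
  have p1 : 0 < x + β := by linarith
  have p2 : 0 < x + α := by linarith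
  have p3 : 0 < x - 1 + β := by linarith
  have p4 : 0 < x - 1 + α := by linarith
  have h1 := log_div_le p1 h
  have h2 : Real.log ((x + α) / (x + β)) - Real.log ((x - 1 + α) / (x - 1 + β)) ≤
      -((α - β) / ((x + β) * (x + α))) := by
    rw [← Real.log_div (div_pos p2 p1).ne' (div_pos p4 p3).ne']
    refine (Real.log_le_sub_one_of_pos (div_pos (div_pos p2 p1) (div_pos p4 p3))).trans ?_
    have e : (x + α) / (x + β) / ((x - 1 + α) / (x - 1 + β)) - 1 =
        -((α - β) / ((x + β) * (x - 1 + α))) := by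
      field_simp
      ring
    rw [e, neg_le_neg_iff]
    exact div_le_div_of_nonneg_left (by linarith) (by positivity)
      (mul_le_mul_of_nonneg_left (by linarith) p1.le)
  have h3 := mul_le_mul_of_nonneg_left h2 hx
  have e : (α - β) * α / ((x + α) * (x + β)) =
      (α - β) / (x + β) + x * -((α - β) / ((x + β) * (x + α))) := by
    field_simp
    ring
  rw [e]
  linarith

lemma mul_log_increment_le {α β : ℝ} (hβ : 1 < β) (h : β ≤ α) (k l : ℕ) :
    ((l + k : ℕ) : ℝ) * Real.log ((((l + k : ℕ) : ℝ) - 1 + α) / (((l + k : ℕ) : ℝ) - 1 + β)) -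
      (k : ℝ) * Real.log (((k : ℝ) - 1 + α) / ((k : ℝ) - 1 + β)) ≤
      l * ((α - β) * α / ((k + α) * (k + β))) := by
  induction l with
  | zero => simp
  | succ l ih =>
    have h1 := succ_mul_log_sub_le (x := ((l + k : ℕ) : ℝ)) (by positivity) hβ h
    have hk : (0 : ℝ) ≤ k := by positivity
    have hl : (0 : ℝ) ≤ l := by positivity
    have h2 : (α - β) * α / ((((l + k : ℕ) : ℝ) + α) * (((l + k : ℕ) : ℝ) + β)) ≤
        (α - β) * α / ((k + α) * (k + β)) := by
      refine div_le_div_of_nonneg_left (mul_nonneg (by linarith) (by linarith))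
        (mul_pos (by linarith) (by linarith)) ?_
      push_cast
      exact mul_le_mul (by linarith) (by linarith) (by linarith) (by linarith)
    have e : ((l + 1 + k : ℕ) : ℝ) = ((l + k : ℕ) : ℝ) + 1 := by push_cast; ring
    rw [e, add_sub_cancel_right, Nat.cast_succ, add_mul, one_mul]
    linarith

variable {ι : Type*} [Fintype ι] {m : ι → ℝ}

lemma integrable_inv_total (A : Finset ι) {b : ℝ} (hb : 0 < b) :
    Integrable (fun X => 1 / ((total A X : ℝ) + b)) (prodPoisson m) := by
  refine integrable_of_bounded (1 / b) fun X => ?_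
  have : (0 : ℝ) ≤ total A X := by positivity
  rw [abs_of_nonneg (by positivity)]
  exact one_div_le_one_div_of_le hb (by linarith)

lemma integrable_log_total (A : Finset ι) {α β : ℝ} (hβ : 0 < β) (h : β ≤ α) :
    Integrable (fun X => Real.log (((total A X : ℝ) + α) / ((total A X : ℝ) + β)))
      (prodPoisson m) := by
  refine integrable_of_bounded ((α - β) / β) fun X => ?_
  have h0 : (0 : ℝ) ≤ total A X := by positivity
  rw [abs_of_nonneg (log_div_nonneg (by linarith) h)]
  exact (log_div_le (by linarith) h).trans
    (div_le_div_of_nonneg_left (by linarith) hβ (by linarith))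

variable [DecidableEq ι]

lemma integral_inv_total_le (hm : ∀ s, 0 < m s) (A : Finset ι) {b : ℝ} (hb : 1 < b) :
    ∫ X, 1 / ((total A X : ℝ) + b) ∂prodPoisson m ≤ 1 / ((∑ s ∈ A, m s) + b - 1) := by
  have hM : 0 ≤ ∑ s ∈ A, m s := Finset.sum_nonneg fun s _ => (hm s).le
  have hs : ∀ X : ι → ℕ, ((total A X + 1 : ℕ) : ℝ) + (b - 1) = (total A X : ℝ) + b := by
    intro X; push_cast; ring
  have i1 : Integrable (fun X => 1 / ((total A X : ℝ) + b)) (prodPoisson m) :=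
    integrable_inv_total A (by linarith)
  have h1 := integral_total_mul hm A (f := fun k => 1 / ((k : ℝ) + (b - 1)))
    (by simpa only [hs] using i1)
  have i2 := integrable_total_mul hm A (f := fun k => 1 / ((k : ℝ) + (b - 1)))
    (by simpa only [hs] using i1)
  simp only [hs] at h1
  have h2 : ∫ X, (total A X : ℝ) * (1 / ((total A X : ℝ) + (b - 1))) ∂prodPoisson m ≤
      ∫ X, (1 - (b - 1) * (1 / ((total A X : ℝ) + b))) ∂prodPoisson m := by
    refine integral_mono i2 ((integrable_const _).sub (i1.const_mul _)) fun X => ?_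
    have h0 : (0 : ℝ) ≤ total A X := by positivity
    have p1 : 0 < (total A X : ℝ) + (b - 1) := by linarith
    have e : (total A X : ℝ) * (1 / ((total A X : ℝ) + (b - 1))) =
        1 - (b - 1) * (1 / ((total A X : ℝ) + (b - 1))) := by
      field_simp
      ring
    simp only [e]
    have := mul_le_mul_of_nonneg_left
      (one_div_le_one_div_of_le p1 (by linarith : (total A X : ℝ) + (b - 1) ≤ total A X + b))
      (by linarith : (0 : ℝ) ≤ b - 1)
    linarith
  rw [integral_sub (integrable_const _) (i1.const_mul _), integral_const_mul, h1] at h2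
  simp only [integral_const, probReal_univ, one_smul] at h2
  rw [le_div_iff₀ (by linarith)]
  linarith

lemma integral_log_total_le (hm : ∀ s, 0 < m s) (A : Finset ι) {α β : ℝ} (hβ : 1 < β)
    (h : β ≤ α) :
    (∑ s ∈ A, m s) * ∫ X, Real.log (((total A X : ℝ) + α) / ((total A X : ℝ) + β)) ∂prodPoisson m ≤
      (α - β) - (α - β) * (β - 1) / ((∑ s ∈ A, m s) + β - 1) := by
  have hM : 0 ≤ ∑ s ∈ A, m s := Finset.sum_nonneg fun s _ => (hm s).le
  have h1 : ∫ X, Real.log (((total A X : ℝ) + α) / ((total A X : ℝ) + β)) ∂prodPoisson m ≤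
      ∫ X, (α - β) * (1 / ((total A X : ℝ) + β)) ∂prodPoisson m := by
    refine integral_mono (integrable_log_total A (by linarith) h)
      ((integrable_inv_total A (by linarith)).const_mul _) fun X => ?_
    have h0 : (0 : ℝ) ≤ total A X := by positivity
    have := log_div_le (x := (total A X : ℝ)) (by linarith : 0 < (total A X : ℝ) + β) h
    simpa [div_eq_mul_inv] using this
  rw [integral_const_mul] at h1
  have h2 := mul_le_mul_of_nonneg_left (integral_inv_total_le hm A hβ)
    (by linarith : 0 ≤ α - β)
  have h3 := mul_le_mul_of_nonneg_left (h1.trans h2) hM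
  refine h3.trans (le_of_eq ?_)
  have : (∑ s ∈ A, m s) + β - 1 ≠ 0 := by linarith
  field_simp
  ring

lemma integral_log_total_increment_le (hm : ∀ s, 0 < m s) (B : Finset ι) (hB : B.Nonempty)
    {s : ι} (hs : s ∉ B) {α β : ℝ} (hβ : 2 < β) (h : β ≤ α) :
    (∑ t ∈ insert s B, m t) * ∫ X, Real.log (((total (insert s B) X : ℝ) + α) /
          ((total (insert s B) X : ℝ) + β)) ∂prodPoisson m -
      (∑ t ∈ B, m t) * ∫ X, Real.log (((total B X : ℝ) + α) /
          ((total B X : ℝ) + β)) ∂prodPoisson m ≤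
      m s / (∑ t ∈ B, m t) * ((α - β) * α / ((∑ t ∈ B, m t) + β - 2)) := by
  have hM : 0 < ∑ t ∈ B, m t := Finset.sum_pos (fun t _ => hm t) hB
  set f : ℕ → ℝ := fun k => Real.log (((k : ℝ) - 1 + α) / ((k : ℝ) - 1 + β)) with hf
  have hfs : ∀ k : ℕ, f (k + 1) = Real.log (((k : ℝ) + α) / ((k : ℝ) + β)) := by
    intro k; simp [hf]
  have i0 : ∀ A : Finset ι, Integrable (fun X => f (total A X + 1)) (prodPoisson m) := by
    intro A
    simp only [hfs]
    exact integrable_log_total A (by linarith) h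
  have e1 : ∀ A : Finset ι, (∑ t ∈ A, m t) * ∫ X, Real.log (((total A X : ℝ) + α) /
      ((total A X : ℝ) + β)) ∂prodPoisson m =
      ∫ X, (total A X : ℝ) * f (total A X) ∂prodPoisson m := by
    intro A
    rw [integral_total_mul hm A (i0 A)]
    simp only [hfs]
  rw [e1, e1, ← integral_sub (integrable_total_mul hm _ (i0 _)) (integrable_total_mul hm _ (i0 _))]
  set g : ℕ → ℝ := fun k => (α - β) * α / ((k + α) * (k + β)) with hg
  have ig : Integrable (fun X => g (total B X)) (prodPoisson m) := by
    refine integrable_of_bounded ((α - β) * α / (α * β)) fun X => ?_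
    have h0 : (0 : ℝ) ≤ total B X := by positivity
    have p : 0 ≤ (α - β) * α := mul_nonneg (by linarith) (by linarith)
    have q : 0 < α * β := mul_pos (by linarith) (by linarith)
    have r : α * β ≤ (total B X + α) * (total B X + β) :=
      mul_le_mul (by linarith) (by linarith) (by linarith) (by linarith)
    rw [abs_of_nonneg (div_nonneg p (by linarith))]
    exact div_le_div_of_nonneg_left p q r
  have igs : Integrable (fun X => (X s : ℝ) * g (total B X)) (prodPoisson m) := by
    refine integrable_coord_mul hm s (f := fun X => g (total B X)) ?_
    simpa only [total_shiftAt_of_notMem hs] using ig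
  have step1 : ∫ X, ((total (insert s B) X : ℝ) * f (total (insert s B) X) -
      (total B X : ℝ) * f (total B X)) ∂prodPoisson m ≤ m s * ∫ X, g (total B X) ∂prodPoisson m := by
    have e2 := integral_coord_mul hm s fun X => g (total B X)
    simp only [total_shiftAt_of_notMem hs] at e2
    rw [← e2]
    refine integral_mono ((integrable_total_mul hm _ (i0 _)).sub (integrable_total_mul hm _ (i0 _)))
      igs fun X => ?_
    have : total (insert s B) X = X s + total B X := by
      simp [total, Finset.sum_insert hs]
    simp only [this]
    exact mul_log_increment_le (by linarith) h (total B X) (X s)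
  have step2 : (∑ t ∈ B, m t) * ∫ X, g (total B X) ∂prodPoisson m ≤
      (α - β) * α / ((∑ t ∈ B, m t) + β - 2) := by
    set g' : ℕ → ℝ := fun k => (α - β) * α / ((k - 1 + α) * (k - 1 + β)) with hg'
    have hgs : ∀ k : ℕ, g' (k + 1) = g k := by
      intro k; simp [hg, hg']
    have e3 := integral_total_mul hm B (f := g') (by simpa only [hgs] using ig)
    have i3 := integrable_total_mul hm B (f := g') (by simpa only [hgs] using ig)
    simp only [hgs] at e3
    rw [← e3]
    have h4 : ∫ X, (total B X : ℝ) * g' (total B X) ∂prodPoisson m ≤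
        ∫ X, (α - β) * α * (1 / ((total B X : ℝ) + (β - 1))) ∂prodPoisson m := by
      refine integral_mono i3 ((integrable_inv_total B (by linarith)).const_mul _) fun X => ?_
      have h0 : (0 : ℝ) ≤ total B X := by positivity
      have p : 0 ≤ (α - β) * α := mul_nonneg (by linarith) (by linarith)
      simp only [hg']
      have q1 : 0 < (total B X : ℝ) - 1 + α := by linarith
      have q2 : 0 < (total B X : ℝ) - 1 + β := by linarith
      have e : (total B X : ℝ) * ((α - β) * α / ((total B X - 1 + α) * (total B X - 1 + β))) =
          (α - β) * α * (total B X / (total B X - 1 + α) * (1 / (total B X - 1 + β))) := by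
        field_simp
      rw [e]
      refine mul_le_mul_of_nonneg_left ?_ p
      have r : (total B X : ℝ) / (total B X - 1 + α) ≤ 1 := (div_le_one q1).2 (by linarith)
      have e' : (total B X : ℝ) + (β - 1) = total B X - 1 + β := by ring
      rw [e']
      exact mul_le_of_le_one_left (by positivity) r
    refine h4.trans ?_
    rw [integral_const_mul]
    refine (mul_le_mul_of_nonneg_left (integral_inv_total_le hm B (by linarith))
      (mul_nonneg (by linarith) (by linarith))).trans (le_of_eq ?_)
    rw [mul_one_div]
    congr 1
    ring
  refine step1.trans ?_
  have e5 : m s * ∫ X, g (total B X) ∂prodPoisson m =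
      m s / (∑ t ∈ B, m t) * ((∑ t ∈ B, m t) * ∫ X, g (total B X) ∂prodPoisson m) := by
    field_simp
  rw [e5]
  exact mul_le_mul_of_nonneg_left step2 (div_nonneg (hm s).le hM.le)

end PoissonBounds

section Hierarchy

variable {n : ℕ → ℕ} {D : ℕ}

/-- Extension of an index by one further coordinate. -/
def snocIdx {d : ℕ} (i : Idx n d) (k : Fin (n (d + 1))) : Idx n (d + 1) :=
  Fin.snoc (α := fun k : Fin (d + 1) => Fin (n (k.val + 1))) i k

lemma resIdx_snocIdx {d : ℕ} (i : Idx n d) (k : Fin (n (d + 1))) :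
    resIdx n (Nat.le_succ d) (snocIdx i k) = i := by
  funext l
  exact Fin.snoc_castSucc (α := fun k : Fin (d + 1) => Fin (n (k.val + 1))) k i l

lemma sum_idx_succ {d : ℕ} (F : Idx n (d + 1) → ℝ) :
    ∑ i2, F i2 = ∑ i : Idx n d, ∑ k, F (snocIdx i k) := by
  rw [← (Fin.snocEquiv fun k : Fin (d + 1) => Fin (n (k.val + 1))).sum_comp,
    Fintype.sum_prod_type_right]
  rfl

lemma sum_idx_succ_fiber {d : ℕ} (i : Idx n d) (F : Idx n (d + 1) → ℝ) :
    (∑ i2, if resIdx n (Nat.le_succ d) i2 = i then F i2 else 0) = ∑ k, F (snocIdx i k) := by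
  rw [sum_idx_succ, Finset.sum_eq_single i]
  · simp only [resIdx_snocIdx, if_true]
  · intro b _ hb
    simp only [resIdx_snocIdx, hb, if_false, Finset.sum_const_zero]
  · simp

lemma sum_idx_comp_resIdx {d e : ℕ} (h : d ≤ e) (F : Idx n d → ℝ) :
    ∑ i : Idx n e, F (resIdx n h i) = (∏ l ∈ Finset.Icc (d + 1) e, (n l : ℝ)) * ∑ i, F i := by
  induction e, h using Nat.le_induction with
  | base => simp; rfl
  | succ e h ih =>
    rw [sum_idx_succ, Finset.prod_Icc_succ_top (by omega), mul_right_comm, ← ih, Finset.sum_mul]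
    refine Finset.sum_congr rfl fun i _ => ?_
    have : ∀ k, resIdx n (h.trans (Nat.le_succ e)) (snocIdx i k) = resIdx n h i := by
      intro k
      conv_rhs => rw [← resIdx_snocIdx i k]
      rfl
    simp [this, mul_comm]

lemma sum_marg_mul (v : Idx n D → ℝ) {d : ℕ} (h : d ≤ D) (F : Idx n d → ℝ) :
    ∑ i, marg n D v h i * F i = ∑ j, v j * F (resIdx n h j) := by
  simp only [marg, Finset.sum_mul]
  rw [Finset.sum_comm]
  refine Finset.sum_congr rfl fun j _ => ?_
  simp [ite_mul]

lemma sum_marg_mul_resIdx (v : Idx n D → ℝ) {d e : ℕ} (hde : d ≤ e) (he : e ≤ D)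
    (F : Idx n d → ℝ) :
    ∑ i, marg n D v he i * F (resIdx n hde i) = ∑ i, marg n D v (hde.trans he) i * F i := by
  rw [sum_marg_mul v he fun i => F (resIdx n hde i), sum_marg_mul]
  rfl

lemma marg_eq_sum_fiber (v : Idx n D → ℝ) {d e : ℕ} (hde : d ≤ e) (he : e ≤ D) (i : Idx n d) :
    (∑ i2, if resIdx n hde i2 = i then marg n D v he i2 else 0) = marg n D v (hde.trans he) i := by
  have := sum_marg_mul_resIdx v hde he fun i' => if i' = i then 1 else 0
  simpa using this

lemma marg_self (v : Idx n D → ℝ) (j : Idx n D) : marg n D v le_rfl j = v j := by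
  have h : ∀ j' : Idx n D, resIdx n le_rfl j' = j' := fun _ => rfl
  simp [marg, h]

lemma exists_resIdx_eq (hn : ∀ d, 1 ≤ d → d ≤ D → 1 ≤ n d) {d : ℕ} (h : d ≤ D) (i : Idx n d) :
    ∃ j : Idx n D, resIdx n h j = i := by
  refine ⟨fun k => if hk : k.val < d then i ⟨k.val, hk⟩ else
    ⟨0, hn (k.val + 1) (by omega) k.isLt⟩, ?_⟩
  funext k
  have : (Fin.castLE h k).val < d := k.isLt
  simp only [resIdx, this, dif_pos]
  rfl

lemma marg_pos (hn : ∀ d, 1 ≤ d → d ≤ D → 1 ≤ n d) {v : Idx n D → ℝ} (hv : ∀ j, 0 < v j)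
    {d : ℕ} (h : d ≤ D) (i : Idx n d) : 0 < marg n D v h i := by
  obtain ⟨j, hj⟩ := exists_resIdx_eq hn h i
  refine Finset.sum_pos' (fun j _ => ?_) ⟨j, Finset.mem_univ j, by simp [hj, hv j]⟩
  split_ifs
  exacts [(hv j).le, le_rfl]

/-- The nodes of the hierarchy. -/
abbrev Coord (n : ℕ → ℕ) (D : ℕ) := Σ d : Fin (D + 1), Idx n d.val

/-- The Poisson mean attached to a node. -/
noncomputable def coordMean (n : ℕ → ℕ) (D : ℕ) (v : Idx n D → ℝ) (s : Coord n D) : ℝ :=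
  marg n D v (Nat.lt_succ_iff.mp s.1.isLt) s.2

/-- The nodes extending the node `i`, including `i`. -/
def below (n : ℕ → ℕ) (D : ℕ) {d : ℕ} (i : Idx n d) : Finset (Coord n D) :=
  Finset.univ.filter fun s => ∃ h : d ≤ s.1.val, resIdx n h s.2 = i

/-- The nodes properly extending the node `i`. -/
def strictBelow (n : ℕ → ℕ) (D : ℕ) {d : ℕ} (i : Idx n d) : Finset (Coord n D) :=
  Finset.univ.filter fun s => ∃ h : d + 1 ≤ s.1.val, resIdx n ((Nat.le_succ d).trans h) s.2 = i

lemma notMem_strictBelow {d : ℕ} (h : d ≤ D) (i : Idx n d) :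
    (⟨⟨d, Nat.lt_succ_of_le h⟩, i⟩ : Coord n D) ∉ strictBelow n D i := by
  simp [strictBelow]

lemma below_eq_insert {d : ℕ} (h : d ≤ D) (i : Idx n d) :
    below n D i = insert ⟨⟨d, Nat.lt_succ_of_le h⟩, i⟩ (strictBelow n D i) := by
  ext ⟨⟨e, he⟩, j⟩
  simp only [below, strictBelow, Finset.mem_filter, Finset.mem_univ, true_and, Finset.mem_insert]
  constructor
  · rintro ⟨h1, h2⟩
    rcases h1.eq_or_lt with h3 | h3
    · left
      change d = e at h3
      subst h3
      rw [← h2]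
      rfl
    · exact Or.inr ⟨h3, h2⟩
  · rintro (h1 | ⟨h1, h2⟩)
    · rw [Sigma.mk.injEq] at h1
      obtain ⟨h1, h2⟩ := h1
      rw [Fin.mk.injEq] at h1
      subst h1
      rw [heq_eq_eq] at h2
      exact ⟨le_rfl, h2⟩
    · exact ⟨(Nat.le_succ d).trans h1, h2⟩

lemma plusSum_zero_eq_total (X : Obs n D) {d : ℕ} (hd : d ≤ D) (i : Idx n d) :
    plusSum n D X 0 hd i = total (below n D i) fun s => X s.1 s.2 := by
  rw [plusSum, total, below, Finset.sum_filter, Fintype.sum_sigma]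
  refine Finset.sum_congr rfl fun e _ => ?_
  by_cases h : d ≤ e.val
  · simp [h]
  · simp [h]

lemma sum_plusSum_fiber (X : Obs n D) {d : ℕ} (hd : d + 1 ≤ D) (i : Idx n d) :
    (∑ i2 : Idx n (d + 1), if resIdx n (Nat.le_succ d) i2 = i
      then ((plusSum n D X 0 hd i2 : ℕ) : ℝ) else 0) =
      (total (strictBelow n D i) fun s => X s.1 s.2 : ℕ) := by
  simp only [plusSum_zero_eq_total, total, below, strictBelow, Finset.sum_filter, Nat.cast_sum]
  simp only [← Finset.sum_filter (fun i2 : Idx n (d + 1) => resIdx n (Nat.le_succ d) i2 = i)]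
  rw [Finset.sum_comm]
  refine Finset.sum_congr rfl fun s _ => ?_
  by_cases h : d + 1 ≤ s.1.val
  · simp only [h, exists_true_left]
    rw [Finset.sum_filter, Finset.sum_eq_single (resIdx n h s.2)]
    · have h3 : resIdx n (Nat.le_succ d) (resIdx n h s.2) =
          resIdx n ((Nat.le_succ d).trans h) s.2 := rfl
      simp [h3]
    · intro b _ hb
      simp [hb.symm]
    · simp
  · simp [h]

lemma sum_coordMean_filter (v : Idx n D → ℝ) {d : ℕ} (hd : d ≤ D) (i : Idx n d) (c : ℕ)
    (hc : d ≤ c) :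
    (∑ s : Coord n D, if ∃ h : c ≤ s.1.val, resIdx n (hc.trans h) s.2 = i
      then coordMean n D v s else 0) = ((D + 1 - c : ℕ) : ℝ) * marg n D v hd i := by
  rw [Fintype.sum_sigma]
  have h1 : ∀ e : Fin (D + 1), (∑ j : Idx n e.val,
      if ∃ h : c ≤ e.val, resIdx n (hc.trans h) j = i then coordMean n D v ⟨e, j⟩ else 0) =
      if c ≤ e.val then marg n D v hd i else 0 := by
    intro e
    by_cases h : c ≤ e.val
    · simp only [h, exists_true_left, if_true]
      exact marg_eq_sum_fiber v (hc.trans h) (Nat.lt_succ_iff.mp e.isLt) i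
    · simp [h]
  rw [Finset.sum_congr rfl fun e _ => h1 e,
    Fin.sum_univ_eq_sum_range (fun e => if c ≤ e then marg n D v hd i else 0),
    ← Finset.sum_filter, Finset.sum_const, nsmul_eq_mul]
  congr 2
  have : (Finset.range (D + 1)).filter (fun e => c ≤ e) = Finset.Ico c (D + 1) := by
    ext e; simp [and_comm]
  rw [this, Nat.card_Ico]

lemma sum_coordMean_below (v : Idx n D → ℝ) {d : ℕ} (hd : d ≤ D) (i : Idx n d) :
    ∑ s ∈ below n D i, coordMean n D v s = ((D : ℝ) + 1 - d) * marg n D v hd i := by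
  rw [below, Finset.sum_filter, sum_coordMean_filter v hd i d le_rfl,
    Nat.cast_sub (by omega)]
  push_cast
  ring

lemma sum_coordMean_strictBelow (v : Idx n D → ℝ) {d : ℕ} (hd : d ≤ D) (i : Idx n d) :
    ∑ s ∈ strictBelow n D i, coordMean n D v s = ((D : ℝ) - d) * marg n D v hd i := by
  rw [strictBelow, Finset.sum_filter,
    sum_coordMean_filter v hd i (d + 1) (Nat.le_succ d), Nat.cast_sub (by omega)]
  push_cast
  ring

end Hierarchy

section Estimator

variable {n : ℕ → ℕ} {D : ℕ}

/-- The observations indexed by level and node. -/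
def toObs (Y : Coord n D → ℕ) : Obs n D := fun d i => Y ⟨d, i⟩

/-- The unique node of level `0`. -/
def rootIdx (n : ℕ → ℕ) : Idx n 0 := fun k => k.elim0

lemma eq_rootIdx (i : Idx n 0) : i = rootIdx n := funext fun k => k.elim0

lemma sum_idx_zero (F : Idx n 0 → ℝ) : ∑ i, F i = F (rootIdx n) :=
  Fintype.sum_eq_single _ fun i h => absurd (eq_rootIdx i) h

/-- The estimated conditional proportion of a node within its parent. -/
noncomputable def bayesRatio (a : ℕ → ℝ) (Y : Coord n D → ℕ) {d : ℕ} (i : Idx n (d + 1)) : ℝ :=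
  ((total (below n D i) Y : ℝ) + a (d + 1)) /
    ((total (strictBelow n D (resIdx n (Nat.le_succ d) i)) Y : ℝ) + (n (d + 1) : ℝ) * a (d + 1))

lemma hierBayes_toObs (a : ℕ → ℝ) (Y : Coord n D → ℕ) (j : Idx n D) :
    hierBayes n D a 0 (toObs Y) j =
      ((total (below n D (rootIdx n)) Y : ℝ) + a 0) / (1 + D) *
        ∏ k : Fin D, bayesRatio a Y (resIdx n k.isLt j) := by
  simp only [hierBayes]
  congr 1
  · rw [plusSum_zero_eq_total, Nat.cast_zero, sub_zero]
    rfl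
  · refine Finset.prod_congr rfl fun k _ => ?_
    rw [sum_plusSum_fiber, plusSum_zero_eq_total]
    rfl

lemma sum_total_snocIdx (Y : Coord n D → ℕ) {d : ℕ} (hd : d + 1 ≤ D) (i : Idx n d) :
    ∑ k, (total (below n D (snocIdx i k)) Y : ℝ) = total (strictBelow n D i) Y := by
  have h := sum_plusSum_fiber (toObs Y) hd i
  rw [sum_idx_succ_fiber] at h
  simp only [plusSum_zero_eq_total] at h
  exact h

lemma sum_bayesRatio {a : ℕ → ℝ} (Y : Coord n D → ℕ) {d : ℕ} (hd : d + 1 ≤ D) (i : Idx n d)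
    (hn : 1 ≤ n (d + 1)) (ha : 0 < a (d + 1)) :
    ∑ k, bayesRatio a Y (snocIdx i k) = 1 := by
  have h1 : (1 : ℝ) ≤ n (d + 1) := by exact_mod_cast hn
  have h2 : (0 : ℝ) < (total (strictBelow n D i) Y : ℝ) + (n (d + 1) : ℝ) * a (d + 1) := by
    positivity
  simp only [bayesRatio, resIdx_snocIdx]
  rw [← Finset.sum_div, Finset.sum_add_distrib, sum_total_snocIdx Y hd i]
  simp only [Finset.sum_const, Finset.card_univ, Fintype.card_fin, nsmul_eq_mul]
  exact div_self h2.ne'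

lemma marg_hierBayes (hn : ∀ d, 1 ≤ d → d ≤ D → 1 ≤ n d) {a : ℕ → ℝ}
    (ha : ∀ d ≤ D, 0 < a d) (Y : Coord n D → ℕ) {d : ℕ} (h : d ≤ D) (i : Idx n d) :
    marg n D (hierBayes n D a 0 (toObs Y)) h i =
      ((total (below n D (rootIdx n)) Y : ℝ) + a 0) / (1 + D) *
        ∏ k : Fin d, bayesRatio a Y (resIdx n k.isLt i) := by
  induction h using Nat.decreasingInduction with
  | self => rw [marg_self, hierBayes_toObs]
  | of_succ d h ih =>
    rw [← marg_eq_sum_fiber _ (Nat.le_succ d) h i, sum_idx_succ_fiber]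
    simp only [ih]
    rw [← Finset.mul_sum]
    congr 1
    have h1 : ∀ k, ∏ l : Fin (d + 1), bayesRatio a Y (resIdx n l.isLt (snocIdx i k)) =
        (∏ l : Fin d, bayesRatio a Y (resIdx n l.isLt i)) * bayesRatio a Y (snocIdx i k) := by
      intro k
      rw [Fin.prod_univ_castSucc]
      congr 1
      refine Finset.prod_congr rfl fun l _ => ?_
      conv_rhs => rw [← resIdx_snocIdx i k]
      rfl
    simp only [h1]
    rw [← Finset.mul_sum, sum_bayesRatio Y h i (hn _ (by omega) h) (ha _ h), mul_one]

lemma bayesRatio_pos (hn : ∀ d, 1 ≤ d → d ≤ D → 1 ≤ n d) {a : ℕ → ℝ}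
    (ha : ∀ d ≤ D, 0 < a d) (Y : Coord n D → ℕ) {d : ℕ} (hd : d + 1 ≤ D) (i : Idx n (d + 1)) :
    0 < bayesRatio a Y i := by
  have h1 : (1 : ℝ) ≤ n (d + 1) := by exact_mod_cast hn _ (by omega) hd
  have h2 := ha _ hd
  unfold bayesRatio
  positivity

lemma marg_hierBayes_pos (hn : ∀ d, 1 ≤ d → d ≤ D → 1 ≤ n d) {a : ℕ → ℝ}
    (ha : ∀ d ≤ D, 0 < a d) (Y : Coord n D → ℕ) {d : ℕ} (h : d ≤ D) (i : Idx n d) :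
    0 < marg n D (hierBayes n D a 0 (toObs Y)) h i := by
  rw [marg_hierBayes hn ha Y h]
  have h0 := ha 0 (Nat.zero_le D)
  refine mul_pos (by positivity) (Finset.prod_pos fun k _ => ?_)
  exact bayesRatio_pos hn ha Y (k.isLt.trans_le h) _

lemma log_marg_hierBayes (hn : ∀ d, 1 ≤ d → d ≤ D → 1 ≤ n d) {a : ℕ → ℝ}
    (ha : ∀ d ≤ D, 0 < a d) (Y : Coord n D → ℕ) {d : ℕ} (h : d ≤ D) (i : Idx n d) :
    Real.log (marg n D (hierBayes n D a 0 (toObs Y)) h i) =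
      Real.log ((total (below n D (rootIdx n)) Y : ℝ) + a 0) - Real.log (1 + D) +
        ∑ k : Fin d, Real.log (bayesRatio a Y (resIdx n k.isLt i)) := by
  have h0 := ha 0 (Nat.zero_le D)
  have h1 : ∀ k : Fin d, bayesRatio a Y (resIdx n k.isLt i) ≠ 0 := fun k =>
    (bayesRatio_pos hn ha Y (k.isLt.trans_le h) _).ne'
  rw [marg_hierBayes hn ha Y h, Real.log_mul (by positivity)
    (Finset.prod_ne_zero_iff.2 fun k _ => h1 k), Real.log_div (by positivity) (by positivity),
    Real.log_prod fun k _ => h1 k]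

lemma sum_marg_hierBayes (hn : ∀ d, 1 ≤ d → d ≤ D → 1 ≤ n d) {a : ℕ → ℝ}
    (ha : ∀ d ≤ D, 0 < a d) (Y : Coord n D → ℕ) {d : ℕ} (h : d ≤ D) :
    ∑ i, marg n D (hierBayes n D a 0 (toObs Y)) h i =
      ((total (below n D (rootIdx n)) Y : ℝ) + a 0) / (1 + D) := by
  have h1 := sum_marg_mul_resIdx (hierBayes n D a 0 (toObs Y)) (Nat.zero_le d) h fun _ => 1
  simp only [mul_one] at h1
  rw [h1, sum_idx_zero, marg_hierBayes hn ha]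
  simp

/-- The sum over the nodes of level `d + 1` of the mean times the log conditional proportion. -/
noncomputable def logRatioSum (v : Idx n D → ℝ) (a : ℕ → ℝ) (Y : Coord n D → ℕ) (d : ℕ) : ℝ :=
  if h : d + 1 ≤ D then ∑ i, marg n D v h i * Real.log (bayesRatio a Y i) else 0

lemma sum_range_sum_range (H : ℕ → ℝ) (D : ℕ) :
    ∑ d ∈ Finset.range (D + 1), ∑ k ∈ Finset.range d, H k =
      ∑ k ∈ Finset.range D, ((D : ℝ) - k) * H k := by
  induction D with
  | zero => simp
  | succ D ih =>
    rw [Finset.sum_range_succ, ih, Finset.sum_range_succ _ D, Finset.sum_range_succ _ D,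
      ← add_assoc, ← Finset.sum_add_distrib]
    push_cast
    congr 1
    · exact Finset.sum_congr rfl fun k _ => by ring
    · ring

/-- The part of the entropy loss which does not depend on the estimator. -/
noncomputable def lossConst (n : ℕ → ℕ) (D : ℕ) (v : Idx n D → ℝ) : ℝ :=
  ∑ d : Fin (D + 1), ∑ i : Idx n d.val, coordMean n D v ⟨d, i⟩ *
    (Real.log (coordMean n D v ⟨d, i⟩) - 1 + Real.log (1 + D))

lemma hierLoss_hierBayes (hn : ∀ d, 1 ≤ d → d ≤ D → 1 ≤ n d) {a : ℕ → ℝ}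
    (ha : ∀ d ≤ D, 0 < a d) {v : Idx n D → ℝ} (hv : ∀ j, 0 < v j) (Y : Coord n D → ℕ) :
    hierLoss n D (hierBayes n D a 0 (toObs Y)) v =
      lossConst n D v + ((total (below n D (rootIdx n)) Y : ℝ) + a 0)
      - (D + 1) * marg n D v (Nat.zero_le D) (rootIdx n) *
          Real.log ((total (below n D (rootIdx n)) Y : ℝ) + a 0)
      - ∑ k ∈ Finset.range D, ((D : ℝ) - k) * logRatioSum v a Y k := by
  set δ := hierBayes n D a 0 (toObs Y) with hδ
  set L := Real.log ((total (below n D (rootIdx n)) Y : ℝ) + a 0) with hL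
  have key : ∀ d : Fin (D + 1), (∑ i : Idx n d.val,
      marg n D v (Nat.lt_succ_iff.mp d.isLt) i *
      (marg n D δ (Nat.lt_succ_iff.mp d.isLt) i / marg n D v (Nat.lt_succ_iff.mp d.isLt) i - 1 -
        Real.log (marg n D δ (Nat.lt_succ_iff.mp d.isLt) i /
          marg n D v (Nat.lt_succ_iff.mp d.isLt) i))) =
      (∑ i : Idx n d.val, coordMean n D v ⟨d, i⟩ *
        (Real.log (coordMean n D v ⟨d, i⟩) - 1 + Real.log (1 + D))) +
      ((total (below n D (rootIdx n)) Y : ℝ) + a 0) / (1 + D)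
      - marg n D v (Nat.zero_le D) (rootIdx n) * L
      - ∑ k ∈ Finset.range d.val, logRatioSum v a Y k := by
    rintro ⟨d, hd⟩
    have hd' : d ≤ D := Nat.lt_succ_iff.mp hd
    have e1 := sum_marg_hierBayes hn ha Y hd'
    have e2 : ∑ i, marg n D v hd' i = marg n D v (Nat.zero_le D) (rootIdx n) := by
      have h1 := sum_marg_mul_resIdx v (Nat.zero_le d) hd' fun _ => 1
      simp only [mul_one] at h1
      rw [h1, sum_idx_zero]
    have e3 : ∑ i, marg n D v hd' i * ∑ k : Fin d, Real.log (bayesRatio a Y (resIdx n k.isLt i)) =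
        ∑ k ∈ Finset.range d, logRatioSum v a Y k := by
      simp only [Finset.mul_sum]
      rw [Finset.sum_comm, ← Fin.sum_univ_eq_sum_range]
      refine Finset.sum_congr rfl fun k _ => ?_
      rw [logRatioSum, dif_pos (show k.val + 1 ≤ D from k.isLt.trans_le hd')]
      exact sum_marg_mul_resIdx v (Nat.succ_le_of_lt k.isLt) hd' fun i =>
        Real.log (bayesRatio a Y i)
    rw [← e1, ← e2, ← e3, Finset.sum_mul, ← Finset.sum_add_distrib, ← Finset.sum_sub_distrib,
      ← Finset.sum_sub_distrib]
    refine Finset.sum_congr rfl fun i _ => ?_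
    have p1 := marg_pos hn hv hd' i
    have p2 := marg_hierBayes_pos hn ha Y hd' i
    simp only [coordMean]
    rw [Real.log_div p2.ne' p1.ne', log_marg_hierBayes hn ha Y hd' i]
    field_simp
    ring
  rw [hierLoss, Finset.sum_congr rfl fun d _ => key d, Finset.sum_sub_distrib,
    Finset.sum_sub_distrib, Finset.sum_add_distrib,
    Fin.sum_univ_eq_sum_range fun d => ∑ k ∈ Finset.range d, logRatioSum v a Y k,
    sum_range_sum_range]
  simp only [Finset.sum_const, Finset.card_univ, Fintype.card_fin, nsmul_eq_mul]
  rw [lossConst]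
  have : (1 : ℝ) + D ≠ 0 := by positivity
  push_cast
  field_simp
  ring

end Estimator

section Risk

open MeasureTheory

variable {n : ℕ → ℕ} {D : ℕ}

lemma hierRisk_eq_lintegral (hn : ∀ d, 1 ≤ d → d ≤ D → 1 ≤ n d) {v : Idx n D → ℝ}
    (hv : ∀ j, 0 < v j) (δ : Obs n D → Idx n D → ℝ) :
    hierRisk n D δ v =
      ∫⁻ Y, ENNReal.ofReal (hierLoss n D (δ (toObs Y)) v) ∂prodPoisson (coordMean n D v) := by
  rw [lintegral_countable', hierRisk,
    ← (Equiv.piCurry fun (d : Fin (D + 1)) (_ : Idx n d.val) => ℕ).tsum_eq]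
  refine tsum_congr fun Y => ?_
  have hm : ∀ s, 0 < coordMean n D v s := fun s => marg_pos hn hv _ _
  rw [prodPoisson_singleton hm, ← ENNReal.ofReal_mul']
  · congr 2
    rw [hierPmf, Fintype.prod_sigma]
    rfl
  · refine Finset.prod_nonneg fun s _ => ?_
    have := (hm s).le
    unfold poissonPmf
    positivity

lemma hierLoss_nonneg (hn : ∀ d, 1 ≤ d → d ≤ D → 1 ≤ n d) {a : ℕ → ℝ}
    (ha : ∀ d ≤ D, 0 < a d) {v : Idx n D → ℝ} (hv : ∀ j, 0 < v j) (Y : Coord n D → ℕ) :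
    0 ≤ hierLoss n D (hierBayes n D a 0 (toObs Y)) v := by
  refine Finset.sum_nonneg fun d _ => Finset.sum_nonneg fun i _ => ?_
  have p1 := marg_pos hn hv (Nat.lt_succ_iff.mp d.isLt) i
  have p2 := marg_hierBayes_pos hn ha Y (Nat.lt_succ_iff.mp d.isLt) i
  have := Real.log_le_sub_one_of_pos (div_pos p2 p1)
  exact mul_nonneg p1.le (by linarith)

lemma integrable_log_total_add {ι : Type*} [Fintype ι] [DecidableEq ι] {m : ι → ℝ}
    (hm : ∀ s, 0 < m s) (A : Finset ι) {b : ℝ} (hb : 0 < b) :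
    Integrable (fun X => Real.log ((total A X : ℝ) + b)) (prodPoisson m) := by
  refine integrable_of_linear_bound hm A (b + 1 / b) fun X => ?_
  have h0 : (0 : ℝ) ≤ total A X := by positivity
  have h1 : 0 < (total A X : ℝ) + b := by linarith
  have h2 := Real.log_le_sub_one_of_pos h1
  have h3 := Real.log_le_sub_one_of_pos (inv_pos.2 h1)
  rw [Real.log_inv, ← one_div] at h3
  have h4 := one_div_le_one_div_of_le hb (by linarith : b ≤ (total A X : ℝ) + b)
  have h5 : 0 < 1 / b := by positivity
  rw [abs_le]
  constructor <;> linarith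

lemma log_bayesRatio {a : ℕ → ℝ} (Y : Coord n D → ℕ) {d : ℕ} (i : Idx n (d + 1))
    (hn : 1 ≤ n (d + 1)) (ha : 0 < a (d + 1)) :
    Real.log (bayesRatio a Y i) = Real.log ((total (below n D i) Y : ℝ) + a (d + 1)) -
      Real.log ((total (strictBelow n D (resIdx n (Nat.le_succ d) i)) Y : ℝ) +
        (n (d + 1) : ℝ) * a (d + 1)) := by
  have h1 : (1 : ℝ) ≤ n (d + 1) := by exact_mod_cast hn
  exact Real.log_div (by positivity) (by positivity)

lemma integrable_logRatioSum (hn : ∀ d, 1 ≤ d → d ≤ D → 1 ≤ n d) {a : ℕ → ℝ}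
    (ha : ∀ d ≤ D, 0 < a d) {v : Idx n D → ℝ} (hv : ∀ j, 0 < v j) (d : ℕ) :
    Integrable (fun Y => logRatioSum v a Y d) (prodPoisson (coordMean n D v)) := by
  have hm : ∀ s, 0 < coordMean n D v s := fun s => marg_pos hn hv _ _
  by_cases h : d + 1 ≤ D
  · have h1 : 1 ≤ n (d + 1) := hn _ (by omega) h
    have h1' : (0 : ℝ) < n (d + 1) := by exact_mod_cast h1
    simp only [logRatioSum, dif_pos h, log_bayesRatio _ _ h1 (ha _ h)]
    exact integrable_finsetSum _ fun i _ => ((integrable_log_total_add hm _ (ha _ h)).sub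
      (integrable_log_total_add hm _ (mul_pos h1' (ha _ h)))).const_mul _
  · simp [logRatioSum, h]

lemma integrable_hierLoss (hn : ∀ d, 1 ≤ d → d ≤ D → 1 ≤ n d) {a : ℕ → ℝ}
    (ha : ∀ d ≤ D, 0 < a d) {v : Idx n D → ℝ} (hv : ∀ j, 0 < v j) :
    Integrable (fun Y => hierLoss n D (hierBayes n D a 0 (toObs Y)) v)
      (prodPoisson (coordMean n D v)) := by
  have hm : ∀ s, 0 < coordMean n D v s := fun s => marg_pos hn hv _ _
  simp only [hierLoss_hierBayes hn ha hv]
  refine Integrable.sub (Integrable.sub ((integrable_const _).add ((integrable_total hm _).add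
    (integrable_const _))) ((integrable_log_total_add hm _ (ha 0 (Nat.zero_le D))).const_mul _)) ?_
  exact integrable_finsetSum _ fun k _ => (integrable_logRatioSum hn ha hv k).const_mul _

lemma hierRisk_lt_of_integral_pos (hn : ∀ d, 1 ≤ d → d ≤ D → 1 ≤ n d) {a b : ℕ → ℝ}
    (ha : ∀ d ≤ D, 0 < a d) (hb : ∀ d ≤ D, 0 < b d) {v : Idx n D → ℝ} (hv : ∀ j, 0 < v j)
    (h : 0 < ∫ Y, (hierLoss n D (hierBayes n D a 0 (toObs Y)) v -
      hierLoss n D (hierBayes n D b 0 (toObs Y)) v) ∂prodPoisson (coordMean n D v)) :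
    hierRisk n D (hierBayes n D b 0) v < hierRisk n D (hierBayes n D a 0) v := by
  rw [hierRisk_eq_lintegral hn hv, hierRisk_eq_lintegral hn hv,
    ← ofReal_integral_eq_lintegral_ofReal (integrable_hierLoss hn hb hv)
      (Filter.Eventually.of_forall fun Y => hierLoss_nonneg hn hb hv Y),
    ← ofReal_integral_eq_lintegral_ofReal (integrable_hierLoss hn ha hv)
      (Filter.Eventually.of_forall fun Y => hierLoss_nonneg hn ha hv Y)]
  rw [integral_sub (integrable_hierLoss hn ha hv) (integrable_hierLoss hn hb hv)] at h
  have h0 : 0 ≤ ∫ Y, hierLoss n D (hierBayes n D b 0 (toObs Y)) v ∂prodPoisson (coordMean n D v) :=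
    integral_nonneg fun Y => hierLoss_nonneg hn hb hv Y
  exact (ENNReal.ofReal_lt_ofReal_iff (by linarith)).2 (by linarith)

/-- The expectation of `log ((T + α) / (T + β))` for the total `T` of the nodes in `A`. -/
noncomputable def meanLog (v : Idx n D → ℝ) (A : Finset (Coord n D)) (α β : ℝ) : ℝ :=
  ∫ Y, Real.log (((total A Y : ℝ) + α) / ((total A Y : ℝ) + β)) ∂prodPoisson (coordMean n D v)

/-- The weighted sum of `meanLog` over the level-`d` nodes, counted with all their extensions. -/
noncomputable def belowSum (v : Idx n D → ℝ) (a b : ℕ → ℝ) (d : ℕ) : ℝ :=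
  if h : d ≤ D then
    ∑ i, ((D : ℝ) + 1 - d) * marg n D v h i * meanLog v (below n D i) (a d) (b d) else 0

/-- The weighted sum of `meanLog` over the level-`d` nodes, counted with their proper extensions. -/
noncomputable def strictBelowSum (v : Idx n D → ℝ) (a b : ℕ → ℝ) (d : ℕ) : ℝ :=
  if h : d ≤ D then
    ∑ i, ((D : ℝ) - d) * marg n D v h i * meanLog v (strictBelow n D i) (a d) (b d) else 0

lemma meanLog_eq (hn : ∀ d, 1 ≤ d → d ≤ D → 1 ≤ n d) {v : Idx n D → ℝ} (hv : ∀ j, 0 < v j)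
    (A : Finset (Coord n D)) {α β : ℝ} (hα : 0 < α) (hβ : 0 < β) :
    meanLog v A α β = (∫ Y, Real.log ((total A Y : ℝ) + α) ∂prodPoisson (coordMean n D v)) -
      ∫ Y, Real.log ((total A Y : ℝ) + β) ∂prodPoisson (coordMean n D v) := by
  have hm : ∀ s, 0 < coordMean n D v s := fun s => marg_pos hn hv _ _
  rw [meanLog, ← integral_sub (integrable_log_total_add hm A hα) (integrable_log_total_add hm A hβ)]
  refine integral_congr_ae (Filter.Eventually.of_forall fun Y => ?_)
  exact Real.log_div (by positivity) (by positivity)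

lemma integral_logRatioSum (hn : ∀ d, 1 ≤ d → d ≤ D → 1 ≤ n d) {a : ℕ → ℝ}
    (ha : ∀ d ≤ D, 0 < a d) {v : Idx n D → ℝ} (hv : ∀ j, 0 < v j) {d : ℕ} (h : d + 1 ≤ D) :
    ∫ Y, logRatioSum v a Y d ∂prodPoisson (coordMean n D v) =
      (∑ i, marg n D v h i * ∫ Y, Real.log ((total (below n D i) Y : ℝ) + a (d + 1))
        ∂prodPoisson (coordMean n D v)) -
      ∑ i, marg n D v ((Nat.le_succ d).trans h) i *
        ∫ Y, Real.log ((total (strictBelow n D i) Y : ℝ) + (n (d + 1) : ℝ) * a (d + 1))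
          ∂prodPoisson (coordMean n D v) := by
  have hm : ∀ s, 0 < coordMean n D v s := fun s => marg_pos hn hv _ _
  have h1 : 1 ≤ n (d + 1) := hn _ (by omega) h
  have h1' : (0 : ℝ) < n (d + 1) := by exact_mod_cast h1
  have i1 := fun i : Idx n (d + 1) => integrable_log_total_add hm (below n D i) (ha _ h)
  have i2 := fun i : Idx n (d + 1) => integrable_log_total_add hm
    (strictBelow n D (resIdx n (Nat.le_succ d) i)) (mul_pos h1' (ha _ h))
  simp only [logRatioSum, dif_pos h, log_bayesRatio _ _ h1 (ha _ h)]
  rw [integral_finsetSum, ← sum_marg_mul_resIdx v (Nat.le_succ d) h fun i =>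
    ∫ Y, Real.log ((total (strictBelow n D i) Y : ℝ) + (n (d + 1) : ℝ) * a (d + 1))
      ∂prodPoisson (coordMean n D v), ← Finset.sum_sub_distrib]
  · refine Finset.sum_congr rfl fun i _ => ?_
    rw [integral_const_mul, integral_sub (i1 i) (i2 i), mul_sub]
  · exact fun i _ => ((i1 i).sub (i2 i)).const_mul _

lemma integral_hierLoss_sub (hn : ∀ d, 1 ≤ d → d ≤ D → 1 ≤ n d) {a b : ℕ → ℝ}
    (ha : ∀ d ≤ D, 0 < a d) (hb : ∀ d ≤ D, 0 < b d) {v : Idx n D → ℝ} (hv : ∀ j, 0 < v j)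
    {e : ℕ} (he : e ≤ D) (hab : ∀ d, e < d → d ≤ D → a d = b d)
    (ha' : ∀ k < e, (n (k + 1) : ℝ) * a (k + 1) = a k)
    (hb' : ∀ k < e, (n (k + 1) : ℝ) * b (k + 1) = b k) :
    ∫ Y, (hierLoss n D (hierBayes n D a 0 (toObs Y)) v -
      hierLoss n D (hierBayes n D b 0 (toObs Y)) v) ∂prodPoisson (coordMean n D v) =
      (a 0 - b 0) - belowSum v a b e -
        ∑ k ∈ Finset.range e, (belowSum v a b k - strictBelowSum v a b k) := by
  have hm : ∀ s, 0 < coordMean n D v s := fun s => marg_pos hn hv _ _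
  set T0 : Finset (Coord n D) := below n D (rootIdx n) with hT0
  have ia := integrable_log_total_add hm T0 (ha 0 (Nat.zero_le D))
  have ib := integrable_log_total_add hm T0 (hb 0 (Nat.zero_le D))
  have hloss : ∀ Y : Coord n D → ℕ, hierLoss n D (hierBayes n D a 0 (toObs Y)) v -
      hierLoss n D (hierBayes n D b 0 (toObs Y)) v =
      ((a 0 - b 0) - (D + 1) * marg n D v (Nat.zero_le D) (rootIdx n) *
        (Real.log ((total T0 Y : ℝ) + a 0) - Real.log ((total T0 Y : ℝ) + b 0))) -
      ∑ k ∈ Finset.range e, ((D : ℝ) - k) * (logRatioSum v a Y k - logRatioSum v b Y k) := by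
    intro Y
    have h1 : ∑ k ∈ Finset.range e, ((D : ℝ) - k) * (logRatioSum v a Y k - logRatioSum v b Y k) =
        ∑ k ∈ Finset.range D, ((D : ℝ) - k) * (logRatioSum v a Y k - logRatioSum v b Y k) := by
      refine Finset.sum_subset (Finset.range_mono he) fun k hk hk' => ?_
      rw [Finset.mem_range] at hk hk'
      have h2 : a (k + 1) = b (k + 1) := hab (k + 1) (by omega) (by omega)
      simp [logRatioSum, bayesRatio, h2]
    rw [h1, hierLoss_hierBayes hn ha hv, hierLoss_hierBayes hn hb hv]
    simp only [mul_sub, Finset.sum_sub_distrib]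
    ring
  have hroot : (D + 1) * marg n D v (Nat.zero_le D) (rootIdx n) *
      ((∫ Y, Real.log ((total T0 Y : ℝ) + a 0) ∂prodPoisson (coordMean n D v)) -
        ∫ Y, Real.log ((total T0 Y : ℝ) + b 0) ∂prodPoisson (coordMean n D v)) =
      belowSum v a b 0 := by
    rw [belowSum, dif_pos (Nat.zero_le D), sum_idx_zero,
      meanLog_eq hn hv _ (ha 0 (Nat.zero_le D)) (hb 0 (Nat.zero_le D)), Nat.cast_zero, sub_zero]
  have hstep : ∀ k ∈ Finset.range e, ((D : ℝ) - k) *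
      ((∫ Y, logRatioSum v a Y k ∂prodPoisson (coordMean n D v)) -
        ∫ Y, logRatioSum v b Y k ∂prodPoisson (coordMean n D v)) =
      belowSum v a b (k + 1) - strictBelowSum v a b k := by
    intro k hk
    rw [Finset.mem_range] at hk
    have hk1 : k + 1 ≤ D := by omega
    have hk0 : k ≤ D := by omega
    rw [integral_logRatioSum hn ha hv hk1, integral_logRatioSum hn hb hv hk1, ha' k hk, hb' k hk,
      belowSum, dif_pos hk1, strictBelowSum, dif_pos hk0]
    simp only [meanLog_eq hn hv _ (ha _ hk1) (hb _ hk1), meanLog_eq hn hv _ (ha _ hk0) (hb _ hk0),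
      mul_assoc, ← Finset.mul_sum, mul_sub, Finset.sum_sub_distrib]
    push_cast
    ring
  simp only [hloss]
  rw [integral_sub, integral_sub (integrable_const _), integral_const_mul, integral_sub ia ib,
    hroot, integral_finsetSum]
  · simp only [integral_const_mul, integral_const, probReal_univ, one_smul]
    rw [Finset.sum_congr rfl fun k hk => by
      rw [integral_sub (integrable_logRatioSum hn ha hv k) (integrable_logRatioSum hn hb hv k),
        hstep k hk]]
    have htel := Finset.sum_range_sub (belowSum v a b) e
    simp only [Finset.sum_sub_distrib] at htel ⊢
    linarith
  · exact fun k _ => ((integrable_logRatioSum hn ha hv k).sub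
      (integrable_logRatioSum hn hb hv k)).const_mul _
  · exact (ia.sub ib).const_mul _
  · exact (integrable_const _).sub ((ia.sub ib).const_mul _)
  · exact integrable_finsetSum _ fun k _ => ((integrable_logRatioSum hn ha hv k).sub
      (integrable_logRatioSum hn hb hv k)).const_mul _

end Risk

section Comparison

lemma one_div_tangent {y t : ℝ} (hy : 0 < y) (ht : 0 < t) : 2 / t - y / t ^ 2 ≤ 1 / y := by
  have : 1 / y - (2 / t - y / t ^ 2) = (t - y) ^ 2 / (y * t ^ 2) := by
    field_simp
    ring
  have h2 : 0 ≤ (t - y) ^ 2 / (y * t ^ 2) := by positivity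
  linarith

lemma scalar_comparison {x p q r s N M A nA : ℝ} (hx : 0 < x) (hp : 0 < p) (hq : 0 < q)
    (hqr : q ≤ r) (hrs : r ≤ s) (hN : 1 < N) (hM : 0 < M) (hA : 2 ≤ A) (hnA : 2 < nA)
    (hnM : nA ≤ M * A) (h : N * nA / (nA - 2) ≤ q / p * ((A - 1) / A)) :
    p * ((M * A * N - M * A) * (M * A * N) / (s * (s * x + M * A - 2))) <
      M ^ 2 * ((N - 1) * (A * (A - 1))) / (r * x + M * (A - 1)) := by
  set β := M * A with hβ
  have hβ2 : 2 < β := by linarith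
  have hr : 0 < r := by linarith
  have hs : 0 < s := by linarith
  have hA1 : 0 < A - 1 := by linarith
  have h1 : p * N * A * β ≤ s * (A - 1) * (β - 2) := by
    have h2 : N * nA * (p * A) ≤ q * (A - 1) * (nA - 2) := by
      rw [div_mul_div_comm, div_le_div_iff₀ (by linarith) (by positivity)] at h
      exact h
    have h3 : p * N * A * β * nA ≤ s * (A - 1) * (β - 2) * nA := by
      calc p * N * A * β * nA = N * nA * (p * A) * β := by ring
        _ ≤ q * (A - 1) * (nA - 2) * β := by gcongr
        _ = q * (A - 1) * ((nA - 2) * β) := by ring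
        _ ≤ s * (A - 1) * ((β - 2) * nA) := by
          have h5 : (nA - 2) * β ≤ (β - 2) * nA := by nlinarith
          have h6 : 0 ≤ (nA - 2) * β := mul_nonneg (by linarith) (by linarith)
          have : q ≤ s := hqr.trans hrs
          gcongr
        _ = s * (A - 1) * (β - 2) * nA := by ring
    exact le_of_mul_le_mul_right h3 (by linarith)
  have hd1 : 0 < s * x + β - 2 := by nlinarith
  have hd2 : 0 < r * x + M * (A - 1) := by positivity
  have h4 : (β - 2) * (r * x + M * (A - 1)) < β * (s * x + β - 2) := by
    have h5 : (β - 2) * (r * x) ≤ β * (s * x) := by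
      have : r * x ≤ s * x := by gcongr
      have : 0 < r * x := by positivity
      nlinarith
    have h6 : M * (A - 1) < β := by rw [hβ]; linarith
    nlinarith
  rw [mul_div_assoc', div_lt_div_iff₀ (by positivity) hd2]
  have hN1 : 0 < N - 1 := by linarith
  calc p * ((β * N - β) * (β * N)) * (r * x + M * (A - 1))
      = (N - 1) * M * (p * N * A * β) * (r * x + M * (A - 1)) := by rw [hβ]; ring
    _ ≤ (N - 1) * M * (s * (A - 1) * (β - 2)) * (r * x + M * (A - 1)) := by gcongr
    _ = (N - 1) * M * s * (A - 1) * ((β - 2) * (r * x + M * (A - 1))) := by ring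
    _ < (N - 1) * M * s * (A - 1) * (β * (s * x + β - 2)) := by gcongr
    _ = M ^ 2 * ((N - 1) * (A * (A - 1))) * (s * (s * x + β - 2)) := by rw [hβ]; ring

variable {n : ℕ → ℕ} {D : ℕ}

lemma sum_one_div_marg_ge (hn : ∀ d, 1 ≤ d → d ≤ D → 1 ≤ n d) {v : Idx n D → ℝ}
    (hv : ∀ j, 0 < v j) {k e : ℕ} (hke : k ≤ e) (he : e ≤ D) {r c M : ℝ} (hr : 0 < r)
    (hc : 0 < c) (hM : M = ∏ l ∈ Finset.Icc (k + 1) e, (n l : ℝ)) :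
    ∑ i, M ^ 2 / (r * marg n D v (hke.trans he) i + M * c) ≤
      ∑ i, 1 / (r * marg n D v he i + c) := by
  have hM0 : 0 < M := by
    rw [hM]
    refine Finset.prod_pos fun l hl => ?_
    rw [Finset.mem_Icc] at hl
    exact_mod_cast hn l (by omega) (by omega)
  set t : Idx n k → ℝ := fun i => (r * marg n D v (hke.trans he) i + M * c) / M with ht
  have hp : ∀ i : Idx n k, 0 < marg n D v (hke.trans he) i := marg_pos hn hv _
  have ht0 : ∀ i, 0 < t i := fun i => by
    have := hp i
    simp only [ht]
    positivity
  calc ∑ i, M ^ 2 / (r * marg n D v (hke.trans he) i + M * c)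
      = M * ∑ i, (2 / t i - c / t i ^ 2) -
          ∑ i, marg n D v (hke.trans he) i * (r / t i ^ 2) := by
        rw [Finset.mul_sum, ← Finset.sum_sub_distrib]
        refine Finset.sum_congr rfl fun i _ => ?_
        have := hp i
        have h2 : 0 < r * marg n D v (hke.trans he) i + M * c := by positivity
        simp only [ht]
        field_simp
        ring
    _ = ∑ i : Idx n e, (2 / t (resIdx n hke i) - c / t (resIdx n hke i) ^ 2) -
          ∑ i, marg n D v he i * (r / t (resIdx n hke i) ^ 2) := by
        rw [hM, sum_marg_mul_resIdx v hke he fun i => r / t i ^ 2,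
          sum_idx_comp_resIdx hke fun i => 2 / t i - c / t i ^ 2]
    _ ≤ ∑ i, 1 / (r * marg n D v he i + c) := by
        rw [← Finset.sum_sub_distrib]
        refine Finset.sum_le_sum fun i _ => ?_
        have h1 := marg_pos hn hv he i
        have h2 := one_div_tangent (by positivity : 0 < r * marg n D v he i + c)
          (ht0 (resIdx n hke i))
        refine le_trans (le_of_eq ?_) h2
        ring

lemma belowSum_le (hn : ∀ d, 1 ≤ d → d ≤ D → 1 ≤ n d) {v : Idx n D → ℝ} (hv : ∀ j, 0 < v j)
    {a b : ℕ → ℝ} {d : ℕ} (hd : d ≤ D) (hb : 1 < b d) (hab : b d ≤ a d) :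
    belowSum v a b d ≤ (∏ l ∈ Finset.Icc 1 d, (n l : ℝ)) * (a d - b d) -
      (a d - b d) * (b d - 1) *
        ∑ i, 1 / (((D : ℝ) + 1 - d) * marg n D v hd i + (b d - 1)) := by
  have hm : ∀ s, 0 < coordMean n D v s := fun s => marg_pos hn hv _ _
  rw [belowSum, dif_pos hd]
  have hcard := sum_idx_comp_resIdx (n := n) (Nat.zero_le d) fun _ => a d - b d
  rw [sum_idx_zero, zero_add] at hcard
  rw [← hcard, Finset.mul_sum, ← Finset.sum_sub_distrib]
  refine Finset.sum_le_sum fun i _ => ?_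
  have h := integral_log_total_le hm (below n D i) hb hab
  rw [sum_coordMean_below v hd i] at h
  refine h.trans (le_of_eq ?_)
  rw [add_sub_assoc, mul_one_div]

lemma belowSum_sub_strictBelowSum_le (hn : ∀ d, 1 ≤ d → d ≤ D → 1 ≤ n d) {v : Idx n D → ℝ}
    (hv : ∀ j, 0 < v j) {a b : ℕ → ℝ} {d : ℕ} (hd : d < D) (hb : 2 < b d) (hab : b d ≤ a d) :
    belowSum v a b d - strictBelowSum v a b d ≤
      ∑ i, (a d - b d) * a d /
        (((D : ℝ) - d) * (((D : ℝ) - d) * marg n D v hd.le i + b d - 2)) := by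
  have hm : ∀ s, 0 < coordMean n D v s := fun s => marg_pos hn hv _ _
  have hdD : (0 : ℝ) < (D : ℝ) - d := by
    have : (d : ℝ) < D := by exact_mod_cast hd
    linarith
  rw [belowSum, dif_pos hd.le, strictBelowSum, dif_pos hd.le, ← Finset.sum_sub_distrib]
  refine Finset.sum_le_sum fun i _ => ?_
  have hpos := marg_pos hn hv hd.le i
  have hne : (strictBelow n D i).Nonempty := by
    rw [Finset.nonempty_iff_ne_empty]
    intro h0
    have h1 := sum_coordMean_strictBelow v hd.le i
    rw [h0, Finset.sum_empty] at h1
    exact (mul_pos hdD hpos).ne h1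
  have h := integral_log_total_increment_le hm _ hne (notMem_strictBelow hd.le i) hb hab
  rw [← below_eq_insert hd.le i, sum_coordMean_below v hd.le i,
    sum_coordMean_strictBelow v hd.le i] at h
  refine h.trans (le_of_eq ?_)
  have h2 : 0 < ((D : ℝ) - d) * marg n D v hd.le i + b d - 2 := by
    have := mul_pos hdD hpos
    linarith
  change marg n D v hd.le i / _ * _ = _
  field_simp

end Comparison

section Exponents

variable {n : ℕ → ℕ} {D D0 : ℕ}

lemma aD0_eq_of_lt {e d : ℕ} (he : e < d) : aD0 n D D0 (e + 1) d = aD0 n D D0 e d := by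
  unfold aD0
  split_ifs with h
  · congr 1
    refine Finset.prod_congr rfl fun l hl => ?_
    rw [Finset.mem_Icc] at hl
    have h1 : ¬ l ≤ e + 1 := by omega
    have h2 : ¬ l ≤ e := by omega
    simp [h1, h2]
  · rfl

lemma aD0_eq_of_le {e d : ℕ} (hd : d ≤ e) (he : e ≤ D0) (hD : D0 ≤ D) :
    aD0 n D D0 e d = (∏ l ∈ Finset.Icc (d + 1) e, (n l : ℝ)) *
      ((∏ l ∈ Finset.Icc (D0 + 1) D, (n l : ℝ)) / 2) := by
  have hsub : Finset.Icc (d + 1) e ∪ Finset.Icc (D0 + 1) D ⊆ Finset.Icc (d + 1) D := by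
    intro l
    simp only [Finset.mem_union, Finset.mem_Icc]
    omega
  have hdisj : Disjoint (Finset.Icc (d + 1) e) (Finset.Icc (D0 + 1) D) := by
    rw [Finset.disjoint_left]
    intro l
    simp only [Finset.mem_Icc]
    omega
  rw [← mul_div_assoc, ← Finset.prod_union hdisj]
  unfold aD0
  split_ifs with h
  · congr 1
    rw [← Finset.prod_subset hsub]
    · refine Finset.prod_congr rfl fun l hl => ?_
      simp only [Finset.mem_union, Finset.mem_Icc] at hl
      rw [if_pos (by omega)]
    · intro l hl hl'
      simp only [Finset.mem_union, Finset.mem_Icc] at hl hl'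
      rw [if_neg (by omega)]
  · congr 2
    ext l
    simp only [Finset.mem_union, Finset.mem_Icc]
    omega

lemma aD0_pos (hn : ∀ d, 1 ≤ d → d ≤ D → 1 ≤ n d) (e d : ℕ) : 0 < aD0 n D D0 e d := by
  have hpos : ∀ l ∈ Finset.Icc (d + 1) D, (0 : ℝ) < n l := fun l hl => by
    rw [Finset.mem_Icc] at hl
    exact_mod_cast hn l (by omega) hl.2
  unfold aD0
  split_ifs with h
  · refine div_pos (Finset.prod_pos fun l hl => ?_) two_pos
    split_ifs
    exacts [hpos l hl, one_pos]
  · exact div_pos (Finset.prod_pos hpos) two_pos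

lemma one_le_prod_Icc (hn : ∀ d, 1 ≤ d → d ≤ D → 1 ≤ n d) (d : ℕ) {e : ℕ} (he : e ≤ D) :
    1 ≤ ∏ l ∈ Finset.Icc (d + 1) e, (n l : ℝ) := by
  refine Finset.prod_induction _ (1 ≤ ·) (fun _ _ => one_le_mul_of_one_le_of_one_le) le_rfl
    fun l hl => ?_
  rw [Finset.mem_Icc] at hl
  exact_mod_cast hn l (by omega) (by omega)

end Exponents

/- STATEMENT 17: fix D_0 ∈ {1,…,D} and set a* = (1/2)·Π_{d'=D_0+1}^D n_{d'}.
If n_{D'} ≥ 2 for D' = 1,…,D_0, a* ≥ 2, and for all D' = 2,…,D_0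
((2+D−D_0)/(D_0−1))·((a*−1)/a*) ≥ n_{D'}·(n_{D'−1}·a*)/(n_{D'−1}·a* − 2),
then for every D' ∈ {1,…,D_0}, using all the data X(0), the Bayes estimator with
exponents a^{(D_0)}(D'−1) strictly dominates the one with exponents a^{(D_0)}(D');
in particular the Jeffreys-prior Bayes estimator (exponents a^{(D_0)}(D_0)) is
strictly dominated by the one with exponents a^{(D_0)}(0). -/
theorem stmt_17 (D : ℕ) (hD : 1 ≤ D) (n : ℕ → ℕ)
    (hn : ∀ d, 1 ≤ d → d ≤ D → 1 ≤ n d)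
    (D0 : ℕ) (hD0 : 1 ≤ D0) (hD0D : D0 ≤ D)
    (astar : ℝ) (hastar : astar = (∏ d' ∈ Finset.Icc (D0 + 1) D, (n d' : ℝ)) / 2)
    (hn2 : ∀ D', 1 ≤ D' → D' ≤ D0 → 2 ≤ n D')
    (hastar2 : 2 ≤ astar)
    (hineq : ∀ D', 2 ≤ D' → D' ≤ D0 →
      (n D' : ℝ) * ((n (D' - 1) : ℝ) * astar) / ((n (D' - 1) : ℝ) * astar - 2) ≤
        (2 + (D : ℝ) - (D0 : ℝ)) / ((D0 : ℝ) - 1) * ((astar - 1) / astar))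
    (lam : Idx n D → ℝ) (hlam : ∀ j, 0 < lam j) :
    ∀ D', 1 ≤ D' → D' ≤ D0 →
      hierRisk n D (hierBayes n D (aD0 n D D0 (D' - 1)) 0) lam <
        hierRisk n D (hierBayes n D (aD0 n D D0 D') 0) lam := by
  intro D' h1 h2
  obtain ⟨e, rfl⟩ : ∃ e, D' = e + 1 := ⟨D' - 1, by omega⟩
  rw [Nat.add_sub_cancel]
  set a := aD0 n D D0 (e + 1) with ha
  set b := aD0 n D D0 e with hb
  set N := (n (e + 1) : ℝ) with hN
  have heD : e < D := by omega
  have hN2 : (2 : ℝ) ≤ N := by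
    rw [hN]
    exact_mod_cast hn2 (e + 1) h1 h2
  have hbval : ∀ d ≤ e, b d = (∏ l ∈ Finset.Icc (d + 1) e, (n l : ℝ)) * astar := fun d hd => by
    rw [hb, aD0_eq_of_le hd (by omega) hD0D, hastar]
  have haval : ∀ d ≤ e, a d = b d * N := fun d hd => by
    rw [hbval d hd, ha, aD0_eq_of_le (by omega) h2 hD0D, Finset.prod_Icc_succ_top (by omega),
      ← hastar, hN]
    ring
  have hbstep : ∀ k < e, (n (k + 1) : ℝ) * b (k + 1) = b k := fun k hk => by
    rw [hbval k hk.le, hbval (k + 1) hk, ← mul_assoc,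
      ← Finset.mul_prod_Ioc_eq_prod_Icc (show k + 1 ≤ e from hk), ← Finset.Icc_succ_left_eq_Ioc]
    rfl
  have hastep : ∀ k < e, (n (k + 1) : ℝ) * a (k + 1) = a k := fun k hk => by
    rw [haval k hk.le, haval (k + 1) hk, ← hbstep k hk, mul_assoc]
  have hbe : b e = astar := by simp [hbval e le_rfl]
  have hae : a e = astar * N := by rw [haval e le_rfl, hbe]
  have hle : ∀ d ≤ e, b d ≤ a d := fun d hd => by
    rw [haval d hd]
    exact le_mul_of_one_le_right (aD0_pos hn e d).le (by linarith)
  refine hierRisk_lt_of_integral_pos hn (fun d _ => aD0_pos hn _ d) (fun d _ => aD0_pos hn _ d)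
    hlam ?_
  rw [integral_hierLoss_sub hn (fun d _ => aD0_pos hn _ d) (fun d _ => aD0_pos hn _ d) hlam
    heD.le (fun d hd _ => aD0_eq_of_lt hd) hastep hbstep]
  set r : ℝ := (D : ℝ) + 1 - e with hr
  have hqr : 2 + (D : ℝ) - D0 ≤ r := by
    have : (e : ℝ) + 1 ≤ D0 := by exact_mod_cast h2
    rw [hr]
    linarith
  have hq : 0 < 2 + (D : ℝ) - D0 := by
    have : (D0 : ℝ) ≤ D := by exact_mod_cast hD0D
    linarith
  have hr0 : 0 < r := hq.trans_le hqr
  set S := ∑ i, 1 / (r * marg n D lam heD.le i + (astar - 1)) with hS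
  set W := (N - 1) * (astar * (astar - 1)) * S with hW
  have hmpos : ∀ {d : ℕ} (h : d ≤ D) (i : Idx n d), 0 < marg n D lam h i :=
    fun h i => marg_pos hn hlam h i
  have hidx : ∀ d ≤ D, (Finset.univ : Finset (Idx n d)).Nonempty := fun d hd =>
    ⟨fun k => ⟨0, hn (k.val + 1) (by omega) (by omega)⟩, Finset.mem_univ _⟩
  have hS0 : 0 < S := Finset.sum_pos (fun i _ => by
    have := mul_pos hr0 (hmpos heD.le i)
    exact one_div_pos.2 (by linarith)) (hidx e heD.le)
  have hcoef : 0 < (N - 1) * (astar * (astar - 1)) :=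
    mul_pos (by linarith) (mul_pos (by linarith) (by linarith))
  have hW0 : 0 < W := mul_pos hcoef hS0
  have htop : belowSum lam a b e ≤ (a 0 - b 0) - W := by
    refine (belowSum_le hn hlam heD.le (by linarith) (hle e le_rfl)).trans (le_of_eq ?_)
    rw [haval 0 (Nat.zero_le e), hbval 0 (Nat.zero_le e), hae, hbe, hW, hS, zero_add]
    ring
  have hlevel : ∀ k < e, ((D0 : ℝ) - 1) * (belowSum lam a b k - strictBelowSum lam a b k) < W := by
    intro k hk
    have hp : 0 < (D0 : ℝ) - 1 := by
      have : (2 : ℝ) ≤ D0 := by exact_mod_cast (by omega : 2 ≤ D0)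
      linarith
    have hkD : k < D := hk.trans heD
    set M : ℝ := ∏ l ∈ Finset.Icc (k + 1) e, (n l : ℝ) with hM
    have hne1 : (2 : ℝ) ≤ n e := by exact_mod_cast hn2 e (by omega) (by omega)
    have hneM : (n e : ℝ) ≤ M := by
      obtain ⟨c, rfl⟩ : ∃ c, e = c + 1 := ⟨e - 1, by omega⟩
      rw [hM, Finset.prod_Icc_succ_top (by omega)]
      exact le_mul_of_one_le_left (by linarith) (one_le_prod_Icc hn k (by omega))
    have hbk : b k = M * astar := hbval k hk.le
    have hnA : (n e : ℝ) * astar ≤ M * astar := mul_le_mul_of_nonneg_right hneM (by linarith)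
    have hnA2 : 2 < (n e : ℝ) * astar := by nlinarith
    have hbound := belowSum_sub_strictBelowSum_le hn hlam hkD (by linarith) (hle k hk.le)
    have hjensen := sum_one_div_marg_ge hn hlam hk.le heD.le hr0
      (by linarith : 0 < astar - 1) hM
    have hrs : r ≤ (D : ℝ) - k := by
      have : (k : ℝ) + 1 ≤ e := by exact_mod_cast hk
      rw [hr]
      linarith
    have hcond := hineq (e + 1) (by omega) h2
    rw [Nat.add_sub_cancel] at hcond
    calc ((D0 : ℝ) - 1) * (belowSum lam a b k - strictBelowSum lam a b k)
        ≤ ((D0 : ℝ) - 1) * ∑ i, (a k - b k) * a k /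
            (((D : ℝ) - k) * (((D : ℝ) - k) * marg n D lam hkD.le i + b k - 2)) := by gcongr
      _ < ∑ i : Idx n k, M ^ 2 * ((N - 1) * (astar * (astar - 1))) /
            (r * marg n D lam hkD.le i + M * (astar - 1)) := by
          rw [Finset.mul_sum]
          refine Finset.sum_lt_sum_of_nonempty (hidx k hkD.le) fun i _ => ?_
          rw [haval k hk.le, hbk]
          exact scalar_comparison (hmpos hkD.le i) hp hq hqr hrs (by linarith) (by linarith)
            hastar2 hnA2 hnA hcond
      _ = (N - 1) * (astar * (astar - 1)) *
            ∑ i : Idx n k, M ^ 2 / (r * marg n D lam hkD.le i + M * (astar - 1)) := by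
          rw [Finset.mul_sum]
          exact Finset.sum_congr rfl fun i _ => by ring
      _ ≤ W := by
          rw [hW, hS]
          gcongr
  have hsum : ∑ k ∈ Finset.range e, (belowSum lam a b k - strictBelowSum lam a b k) < W := by
    rcases Nat.eq_zero_or_pos e with h0 | h0
    · rw [h0, Finset.sum_range_zero]
      exact hW0
    · have hp : (e : ℝ) ≤ (D0 : ℝ) - 1 := by
        have : (e : ℝ) + 1 ≤ D0 := by exact_mod_cast h2
        linarith
      have he0 : (0 : ℝ) < e := by exact_mod_cast h0
      have hp0 : 0 < (D0 : ℝ) - 1 := by linarith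
      have h5 : ∑ k ∈ Finset.range e, (belowSum lam a b k - strictBelowSum lam a b k) <
          ∑ _k ∈ Finset.range e, W / ((D0 : ℝ) - 1) :=
        Finset.sum_lt_sum_of_nonempty (Finset.nonempty_range_iff.2 h0.ne') fun k hk =>
          (lt_div_iff₀' hp0).2 (hlevel k (Finset.mem_range.1 hk))
      refine h5.trans_le ?_
      rw [Finset.sum_const, Finset.card_range, nsmul_eq_mul, mul_div_assoc', div_le_iff₀ hp0,
        mul_comm]
      gcongr
  linarith
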